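/- arXiv:1611.00122 — 10 statements merged into one kernel-verified Lean document; each statement's English description precedes it below -/
import Mathlib

section
/- Suppose the subsystems have decoupled controls and 𝓛 = bp(𝓛₁) ∩ bp(𝓛₂). Then for every t ≤ 0 the maximal backward reachable set decomposes exactly: 𝓡(t) = bp(𝓡₁(t)) ∩ bp(𝓡₂(t)). -/
/-- Proposition 1 of the paper. With decoupled controls
`𝒰 = 𝒰₁ × 𝒰₂`, if `𝓛 = bp(𝓛₁) ∩ bp(𝓛₂)` then the maximal BRS decomposes
exactly: `𝓡(t) = bp(𝓡₁(t)) ∩ bp(𝓡₂(t))`. -/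
theorem maxBRS_decomposition_intersection_decoupled
    {X₁ X₂ Xc 𝒰₁ 𝒰₂ : Type*} [Nonempty X₁] [Nonempty X₂] [Nonempty Xc]
    [Nonempty 𝒰₁] [Nonempty 𝒰₂]
    (ξ : ℝ → (X₁ × X₂ × Xc) → ℝ → 𝒰₁ × 𝒰₂ → (X₁ × X₂ × Xc))
    (ξ₁ : ℝ → (X₁ × Xc) → ℝ → 𝒰₁ × 𝒰₂ → (X₁ × Xc))
    (ξ₂ : ℝ → (X₂ × Xc) → ℝ → 𝒰₁ × 𝒰₂ → (X₂ × Xc))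
    (π₁ : (X₁ × X₂ × Xc) → X₁ × Xc) (π₂ : (X₁ × X₂ × Xc) → X₂ × Xc)
    (hπ₁ : ∀ z, π₁ z = (z.1, z.2.2)) (hπ₂ : ∀ z, π₂ z = (z.2.1, z.2.2))
    (hcompat₁ : ∀ s z t u, π₁ (ξ s z t u) = ξ₁ s (π₁ z) t u)
    (hcompat₂ : ∀ s z t u, π₂ (ξ s z t u) = ξ₂ s (π₂ z) t u)
    (hdec₁ : ∀ s y t u₁ u₂ u₂', ξ₁ s y t (u₁, u₂) = ξ₁ s y t (u₁, u₂'))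
    (hdec₂ : ∀ s y t u₁ u₁' u₂, ξ₂ s y t (u₁, u₂) = ξ₂ s y t (u₁', u₂))
    (L : Set (X₁ × X₂ × Xc)) (L₁ : Set (X₁ × Xc)) (L₂ : Set (X₂ × Xc))
    (hL : L = π₁ ⁻¹' L₁ ∩ π₂ ⁻¹' L₂) :
    ∀ t ≤ (0 : ℝ),
      {z | ∃ u : 𝒰₁ × 𝒰₂, ξ 0 z t u ∈ L} =
        π₁ ⁻¹' {y | ∃ u : 𝒰₁ × 𝒰₂, ξ₁ 0 y t u ∈ L₁} ∩
        π₂ ⁻¹' {y | ∃ u : 𝒰₁ × 𝒰₂, ξ₂ 0 y t u ∈ L₂} := by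
  intro t _
  subst hL
  ext z
  simp only [Set.mem_setOf_eq, Set.mem_inter_iff, Set.mem_preimage, hcompat₁, hcompat₂]
  constructor
  · rintro ⟨u, h1, h2⟩
    exact ⟨⟨u, h1⟩, ⟨u, h2⟩⟩
  · rintro ⟨⟨⟨a, b⟩, h1⟩, ⟨⟨c, d⟩, h2⟩⟩
    refine ⟨(a, d), ?_, ?_⟩
    · rw [hdec₁ 0 (π₁ z) t a d b]
      exact h1
    · rw [hdec₂ 0 (π₂ z) t a c d]
      exact h2
end

section
/- Suppose the subsystems have decoupled controls and 𝓛 = bp(𝓛₁) ∪ bp(𝓛₂). Then for every t ≤ 0 the minimal backward reachable set decomposes exactly: 𝓐(t) = bp(𝓐₁(t)) ∪ bp(𝓐₂(t)). -/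
/-- Proposition 2 of the paper. With decoupled controls
`𝒰 = 𝒰₁ × 𝒰₂`, if `𝓛 = bp(𝓛₁) ∪ bp(𝓛₂)` then the minimal BRS decomposes
exactly: `𝓐(t) = bp(𝓐₁(t)) ∪ bp(𝓐₂(t))`. -/
theorem minBRS_decomposition_union_decoupled
    {X₁ X₂ Xc 𝒰₁ 𝒰₂ : Type*} [Nonempty X₁] [Nonempty X₂] [Nonempty Xc]
    [Nonempty 𝒰₁] [Nonempty 𝒰₂]
    (ξ : ℝ → (X₁ × X₂ × Xc) → ℝ → 𝒰₁ × 𝒰₂ → (X₁ × X₂ × Xc))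
    (ξ₁ : ℝ → (X₁ × Xc) → ℝ → 𝒰₁ × 𝒰₂ → (X₁ × Xc))
    (ξ₂ : ℝ → (X₂ × Xc) → ℝ → 𝒰₁ × 𝒰₂ → (X₂ × Xc))
    (π₁ : (X₁ × X₂ × Xc) → X₁ × Xc) (π₂ : (X₁ × X₂ × Xc) → X₂ × Xc)
    (hπ₁ : ∀ z, π₁ z = (z.1, z.2.2)) (hπ₂ : ∀ z, π₂ z = (z.2.1, z.2.2))
    (hcompat₁ : ∀ s z t u, π₁ (ξ s z t u) = ξ₁ s (π₁ z) t u)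
    (hcompat₂ : ∀ s z t u, π₂ (ξ s z t u) = ξ₂ s (π₂ z) t u)
    (hdec₁ : ∀ s y t u₁ u₂ u₂', ξ₁ s y t (u₁, u₂) = ξ₁ s y t (u₁, u₂'))
    (hdec₂ : ∀ s y t u₁ u₁' u₂, ξ₂ s y t (u₁, u₂) = ξ₂ s y t (u₁', u₂))
    (L : Set (X₁ × X₂ × Xc)) (L₁ : Set (X₁ × Xc)) (L₂ : Set (X₂ × Xc))
    (hL : L = π₁ ⁻¹' L₁ ∪ π₂ ⁻¹' L₂) :
    ∀ t ≤ (0 : ℝ),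
      {z | ∀ u : 𝒰₁ × 𝒰₂, ξ 0 z t u ∈ L} =
        π₁ ⁻¹' {y | ∀ u : 𝒰₁ × 𝒰₂, ξ₁ 0 y t u ∈ L₁} ∪
        π₂ ⁻¹' {y | ∀ u : 𝒰₁ × 𝒰₂, ξ₂ 0 y t u ∈ L₂} := by
  intro t _
  subst hL
  ext z
  simp only [Set.mem_setOf_eq, Set.mem_union, Set.mem_preimage, hcompat₁, hcompat₂]
  constructor
  · intro h
    by_contra hc
    rw [not_or, not_forall, not_forall] at hc
    obtain ⟨⟨⟨a₁, a₂⟩, ha⟩, ⟨⟨b₁, b₂⟩, hb⟩⟩ := hc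
    rcases h (a₁, b₂) with h | h
    · exact ha (hdec₁ 0 (π₁ z) t a₁ a₂ b₂ ▸ h)
    · exact hb (hdec₂ 0 (π₂ z) t b₁ a₁ b₂ ▸ h)
  · rintro (h | h) u
    · exact Or.inl (h u)
    · exact Or.inr (h u)
end

section
/- Suppose the subsystems have decoupled controls and 𝓛 = bp(𝓛₁) ∪ bp(𝓛₂). Then for every t ≤ 0 the minimal backward reachable tube decomposes exactly: 𝓐ᵀ(t) = bp(𝓐ᵀ₁(t)) ∪ bp(𝓐ᵀ₂(t)). -/
/-- Proposition 3, eq. (31) of the paper. With decoupled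
controls `𝒰 = 𝒰₁ × 𝒰₂`, if `𝓛 = bp(𝓛₁) ∪ bp(𝓛₂)` then the minimal BRT
decomposes exactly: `𝓐ᵀ(t) = bp(𝓐ᵀ₁(t)) ∪ bp(𝓐ᵀ₂(t))`. -/
theorem minBRT_decomposition_union_decoupled
    {X₁ X₂ Xc 𝒰₁ 𝒰₂ : Type*} [Nonempty X₁] [Nonempty X₂] [Nonempty Xc]
    [Nonempty 𝒰₁] [Nonempty 𝒰₂]
    (ξ : ℝ → (X₁ × X₂ × Xc) → ℝ → 𝒰₁ × 𝒰₂ → (X₁ × X₂ × Xc))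
    (ξ₁ : ℝ → (X₁ × Xc) → ℝ → 𝒰₁ × 𝒰₂ → (X₁ × Xc))
    (ξ₂ : ℝ → (X₂ × Xc) → ℝ → 𝒰₁ × 𝒰₂ → (X₂ × Xc))
    (π₁ : (X₁ × X₂ × Xc) → X₁ × Xc) (π₂ : (X₁ × X₂ × Xc) → X₂ × Xc)
    (hπ₁ : ∀ z, π₁ z = (z.1, z.2.2)) (hπ₂ : ∀ z, π₂ z = (z.2.1, z.2.2))
    (hcompat₁ : ∀ s z t u, π₁ (ξ s z t u) = ξ₁ s (π₁ z) t u)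
    (hcompat₂ : ∀ s z t u, π₂ (ξ s z t u) = ξ₂ s (π₂ z) t u)
    (hdec₁ : ∀ s y t u₁ u₂ u₂', ξ₁ s y t (u₁, u₂) = ξ₁ s y t (u₁, u₂'))
    (hdec₂ : ∀ s y t u₁ u₁' u₂, ξ₂ s y t (u₁, u₂) = ξ₂ s y t (u₁', u₂))
    (L : Set (X₁ × X₂ × Xc)) (L₁ : Set (X₁ × Xc)) (L₂ : Set (X₂ × Xc))
    (hL : L = π₁ ⁻¹' L₁ ∪ π₂ ⁻¹' L₂) :
    ∀ t ≤ (0 : ℝ),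
      {z | ∀ u : 𝒰₁ × 𝒰₂, ∃ s ∈ Set.Icc t 0, ξ s z t u ∈ L} =
        π₁ ⁻¹' {y | ∀ u : 𝒰₁ × 𝒰₂, ∃ s ∈ Set.Icc t 0, ξ₁ s y t u ∈ L₁} ∪
        π₂ ⁻¹' {y | ∀ u : 𝒰₁ × 𝒰₂, ∃ s ∈ Set.Icc t 0, ξ₂ s y t u ∈ L₂} := by
  intro t _
  subst hL
  ext z
  simp only [Set.mem_setOf_eq, Set.mem_union, Set.mem_preimage, hcompat₁, hcompat₂]
  constructor
  · intro h
    by_contra hn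
    rw [not_or, not_forall, not_forall] at hn
    obtain ⟨⟨⟨a₁, a₂⟩, ha⟩, ⟨⟨b₁, b₂⟩, hb⟩⟩ := hn
    obtain ⟨s, hs, h1 | h2⟩ := h (a₁, b₂)
    · exact ha ⟨s, hs, by rw [hdec₁ s _ t a₁ a₂ b₂]; exact h1⟩
    · exact hb ⟨s, hs, by rw [hdec₂ s _ t b₁ a₁ b₂]; exact h2⟩
  · rintro (h | h) u
    · obtain ⟨s, hs, h1⟩ := h u
      exact ⟨s, hs, Or.inl h1⟩
    · obtain ⟨s, hs, h1⟩ := h u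
      exact ⟨s, hs, Or.inr h1⟩
end

section
/- For a time-invariant system, the maximal backward reachable tube equals the union of the maximal backward reachable sets over the time horizon: for every t ≤ 0, ⋃_{s ∈ [t, 0]} 𝓡(s) = 𝓡ᵀ(t). -/
/-- Proposition 4 of the paper. For a time-invariant system,
the maximal BRT equals the union over the time horizon of the maximal BRSs:
`⋃_{s ∈ [t,0]} 𝓡(s) = 𝓡ᵀ(t)` for every `t ≤ 0`. -/
theorem maxBRT_eq_union_maxBRS
    {Z U : Type*} [Nonempty Z] [Nonempty U]
    (ξ : ℝ → Z → ℝ → (ℝ → U) → Z)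
    (htinv : ∀ (τ s t : ℝ) (z : Z) (u : ℝ → U),
      ξ s z t u = ξ (s + τ) z (t + τ) (fun r => u (r - τ)))
    (L : Set Z) :
    ∀ t ≤ (0 : ℝ),
      (⋃ s ∈ Set.Icc t (0 : ℝ), {z | ∃ u : ℝ → U, ξ 0 z s u ∈ L}) =
        {z | ∃ u : ℝ → U, ∃ s ∈ Set.Icc t (0 : ℝ), ξ s z t u ∈ L} := by
  intro t ht
  ext z
  simp only [Set.mem_iUnion, Set.mem_setOf_eq, Set.mem_Icc, exists_prop]
  constructor
  · rintro ⟨s, ⟨h1, h2⟩, u, hu⟩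
    rw [htinv (t - s) 0 s z u, show s + (t - s) = t by ring] at hu
    exact ⟨_, 0 + (t - s), ⟨by linarith, by linarith⟩, hu⟩
  · rintro ⟨u, s, ⟨h1, h2⟩, hu⟩
    rw [htinv (-s) s t z u, show s + -s = 0 by ring] at hu
    exact ⟨t + -s, ⟨by linarith, by linarith⟩, _, hu⟩
end

section
/- If the subsystem disturbances have no shared components (disturbances and strategies factor across the subsystems), then the maximal BRS decomposition for a union target remains exact even under disturbances: 𝓛 = bp(𝓛₁) ∪ bp(𝓛₂) implies 𝓡(t) = bp(𝓡₁(t)) ∪ bp(𝓡₂(t)) for every t ≤ 0. -/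
/-- When the subsystem disturbances have no shared components
(disturbances and strategies factor across the subsystems), the maximal BRS
decomposition for a union target remains exact under disturbances:
`𝓛 = bp(𝓛₁) ∪ bp(𝓛₂)` implies `𝓡(t) = bp(𝓡₁(t)) ∪ bp(𝓡₂(t))`. -/
theorem maxBRS_union_exact_factored_disturbance
    {X₁ X₂ Xc 𝒰 𝒟₁ 𝒟₂ : Type*} [Nonempty X₁] [Nonempty X₂] [Nonempty Xc]
    [Nonempty 𝒰] [Nonempty 𝒟₁] [Nonempty 𝒟₂]
    (Γ₁ : Set (𝒰 → 𝒟₁)) (Γ₂ : Set (𝒰 → 𝒟₂))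
    (hΓ₁ : Γ₁.Nonempty) (hΓ₂ : Γ₂.Nonempty)
    (Γ : Set (𝒰 → 𝒟₁ × 𝒟₂))
    (hΓ : Γ = {γ | ∃ γ₁ ∈ Γ₁, ∃ γ₂ ∈ Γ₂, γ = fun u => (γ₁ u, γ₂ u)})
    (ξ : ℝ → (X₁ × X₂ × Xc) → ℝ → 𝒰 → 𝒟₁ × 𝒟₂ → (X₁ × X₂ × Xc))
    (ξ₁ : ℝ → (X₁ × Xc) → ℝ → 𝒰 → 𝒟₁ → (X₁ × Xc))
    (ξ₂ : ℝ → (X₂ × Xc) → ℝ → 𝒰 → 𝒟₂ → (X₂ × Xc))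
    (π₁ : (X₁ × X₂ × Xc) → X₁ × Xc) (π₂ : (X₁ × X₂ × Xc) → X₂ × Xc)
    (hπ₁ : ∀ z, π₁ z = (z.1, z.2.2)) (hπ₂ : ∀ z, π₂ z = (z.2.1, z.2.2))
    (hcompat₁ : ∀ s z t u d₁ d₂, π₁ (ξ s z t u (d₁, d₂)) = ξ₁ s (π₁ z) t u d₁)
    (hcompat₂ : ∀ s z t u d₁ d₂, π₂ (ξ s z t u (d₁, d₂)) = ξ₂ s (π₂ z) t u d₂)
    (L : Set (X₁ × X₂ × Xc)) (L₁ : Set (X₁ × Xc)) (L₂ : Set (X₂ × Xc))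
    (hL : L = π₁ ⁻¹' L₁ ∪ π₂ ⁻¹' L₂) :
    ∀ t ≤ (0 : ℝ),
      {z | ∀ γ ∈ Γ, ∃ u : 𝒰, ξ 0 z t u (γ u) ∈ L} =
        π₁ ⁻¹' {y | ∀ γ₁ ∈ Γ₁, ∃ u : 𝒰, ξ₁ 0 y t u (γ₁ u) ∈ L₁} ∪
        π₂ ⁻¹' {y | ∀ γ₂ ∈ Γ₂, ∃ u : 𝒰, ξ₂ 0 y t u (γ₂ u) ∈ L₂} := by
  intro t _
  subst hΓ hL
  ext z
  simp only [Set.mem_setOf_eq, Set.mem_union, Set.mem_preimage]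
  constructor
  · intro h
    by_contra hn
    rw [not_or] at hn
    obtain ⟨h1, h2⟩ := hn
    push Not at h1 h2
    obtain ⟨g1, hg1, k1⟩ := h1
    obtain ⟨g2, hg2, k2⟩ := h2
    obtain ⟨u, hu⟩ := h _ ⟨g1, hg1, g2, hg2, rfl⟩
    rw [hcompat₁, hcompat₂] at hu
    exact hu.elim (k1 u) (k2 u)
  · rintro h _ ⟨g1, hg1, g2, hg2, rfl⟩
    simp only [hcompat₁, hcompat₂]
    rcases h with h | h
    · obtain ⟨u, hu⟩ := h g1 hg1
      exact ⟨u, Or.inl hu⟩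
    · obtain ⟨u, hu⟩ := h g2 hg2
      exact ⟨u, Or.inr hu⟩
end

section
/- If the subsystem disturbances have no shared components (disturbances and strategies factor across the subsystems), then the minimal BRS decomposition for an intersection target remains exact even under disturbances: 𝓛 = bp(𝓛₁) ∩ bp(𝓛₂) implies 𝓐(t) = bp(𝓐₁(t)) ∩ bp(𝓐₂(t)) for every t ≤ 0. -/
/-- When the subsystem disturbances have no shared components
(disturbances and strategies factor across the subsystems), the minimal BRS
decomposition for an intersection target remains exact under disturbances:
`𝓛 = bp(𝓛₁) ∩ bp(𝓛₂)` implies `𝓐(t) = bp(𝓐₁(t)) ∩ bp(𝓐₂(t))`. -/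
theorem minBRS_intersection_exact_factored_disturbance
    {X₁ X₂ Xc 𝒰 𝒟₁ 𝒟₂ : Type*} [Nonempty X₁] [Nonempty X₂] [Nonempty Xc]
    [Nonempty 𝒰] [Nonempty 𝒟₁] [Nonempty 𝒟₂]
    (Γ₁ : Set (𝒰 → 𝒟₁)) (Γ₂ : Set (𝒰 → 𝒟₂))
    (hΓ₁ : Γ₁.Nonempty) (hΓ₂ : Γ₂.Nonempty)
    (Γ : Set (𝒰 → 𝒟₁ × 𝒟₂))
    (hΓ : Γ = {γ | ∃ γ₁ ∈ Γ₁, ∃ γ₂ ∈ Γ₂, γ = fun u => (γ₁ u, γ₂ u)})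
    (ξ : ℝ → (X₁ × X₂ × Xc) → ℝ → 𝒰 → 𝒟₁ × 𝒟₂ → (X₁ × X₂ × Xc))
    (ξ₁ : ℝ → (X₁ × Xc) → ℝ → 𝒰 → 𝒟₁ → (X₁ × Xc))
    (ξ₂ : ℝ → (X₂ × Xc) → ℝ → 𝒰 → 𝒟₂ → (X₂ × Xc))
    (π₁ : (X₁ × X₂ × Xc) → X₁ × Xc) (π₂ : (X₁ × X₂ × Xc) → X₂ × Xc)
    (hπ₁ : ∀ z, π₁ z = (z.1, z.2.2)) (hπ₂ : ∀ z, π₂ z = (z.2.1, z.2.2))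
    (hcompat₁ : ∀ s z t u d₁ d₂, π₁ (ξ s z t u (d₁, d₂)) = ξ₁ s (π₁ z) t u d₁)
    (hcompat₂ : ∀ s z t u d₁ d₂, π₂ (ξ s z t u (d₁, d₂)) = ξ₂ s (π₂ z) t u d₂)
    (L : Set (X₁ × X₂ × Xc)) (L₁ : Set (X₁ × Xc)) (L₂ : Set (X₂ × Xc))
    (hL : L = π₁ ⁻¹' L₁ ∩ π₂ ⁻¹' L₂) :
    ∀ t ≤ (0 : ℝ),
      {z | ∃ γ ∈ Γ, ∀ u : 𝒰, ξ 0 z t u (γ u) ∈ L} =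
        π₁ ⁻¹' {y | ∃ γ₁ ∈ Γ₁, ∀ u : 𝒰, ξ₁ 0 y t u (γ₁ u) ∈ L₁} ∩
        π₂ ⁻¹' {y | ∃ γ₂ ∈ Γ₂, ∀ u : 𝒰, ξ₂ 0 y t u (γ₂ u) ∈ L₂} := by
  intro t _
  subst hΓ hL
  ext z
  constructor
  · rintro ⟨γ, ⟨γ₁, h₁, γ₂, h₂, rfl⟩, h⟩
    refine ⟨⟨γ₁, h₁, fun u => ?_⟩, ⟨γ₂, h₂, fun u => ?_⟩⟩
    · rw [← hcompat₁ 0 z t u (γ₁ u) (γ₂ u)]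
      exact (h u).1
    · rw [← hcompat₂ 0 z t u (γ₁ u) (γ₂ u)]
      exact (h u).2
  · rintro ⟨⟨γ₁, h₁, k₁⟩, ⟨γ₂, h₂, k₂⟩⟩
    refine ⟨fun u => (γ₁ u, γ₂ u), ⟨γ₁, h₁, γ₂, h₂, rfl⟩, fun u => ⟨?_, ?_⟩⟩
    · rw [Set.mem_preimage, hcompat₁]
      exact k₁ u
    · rw [Set.mem_preimage, hcompat₂]
      exact k₂ u
end

section
/- For subsystems with decoupled controls but a shared disturbance, if 𝓛 = bp(𝓛₁) ∩ bp(𝓛₂), then for every t ≤ 0 the reconstruction is a conservative under-approximation of the maximal backward reachable set: 𝓡(t) ⊇ bp(𝓡₁(t)) ∩ bp(𝓡₂(t)). -/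
/-- Corollary 5 of the paper. Decoupled controls
`𝒰 = 𝒰₁ × 𝒰₂` but a shared disturbance (with `Γ` the set of all strategies
`𝒰 → 𝒟`): if `𝓛 = bp(𝓛₁) ∩ bp(𝓛₂)` then the reconstruction
under-approximates the maximal BRS: `𝓡(t) ⊇ bp(𝓡₁(t)) ∩ bp(𝓡₂(t))`. -/
theorem maxBRS_intersection_superset_decoupled_disturbance
    {X₁ X₂ Xc 𝒰₁ 𝒰₂ 𝒟 : Type*} [Nonempty X₁] [Nonempty X₂] [Nonempty Xc]
    [Nonempty 𝒰₁] [Nonempty 𝒰₂] [Nonempty 𝒟]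
    (ξ : ℝ → (X₁ × X₂ × Xc) → ℝ → 𝒰₁ × 𝒰₂ → 𝒟 → (X₁ × X₂ × Xc))
    (ξ₁ : ℝ → (X₁ × Xc) → ℝ → 𝒰₁ × 𝒰₂ → 𝒟 → (X₁ × Xc))
    (ξ₂ : ℝ → (X₂ × Xc) → ℝ → 𝒰₁ × 𝒰₂ → 𝒟 → (X₂ × Xc))
    (π₁ : (X₁ × X₂ × Xc) → X₁ × Xc) (π₂ : (X₁ × X₂ × Xc) → X₂ × Xc)
    (hπ₁ : ∀ z, π₁ z = (z.1, z.2.2)) (hπ₂ : ∀ z, π₂ z = (z.2.1, z.2.2))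
    (hcompat₁ : ∀ s z t u d, π₁ (ξ s z t u d) = ξ₁ s (π₁ z) t u d)
    (hcompat₂ : ∀ s z t u d, π₂ (ξ s z t u d) = ξ₂ s (π₂ z) t u d)
    (hdec₁ : ∀ s y t u₁ u₂ u₂' d, ξ₁ s y t (u₁, u₂) d = ξ₁ s y t (u₁, u₂') d)
    (hdec₂ : ∀ s y t u₁ u₁' u₂ d, ξ₂ s y t (u₁, u₂) d = ξ₂ s y t (u₁', u₂) d)
    (L : Set (X₁ × X₂ × Xc)) (L₁ : Set (X₁ × Xc)) (L₂ : Set (X₂ × Xc))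
    (hL : L = π₁ ⁻¹' L₁ ∩ π₂ ⁻¹' L₂) :
    ∀ t ≤ (0 : ℝ),
      {z | ∀ γ : 𝒰₁ × 𝒰₂ → 𝒟, ∃ u : 𝒰₁ × 𝒰₂, ξ 0 z t u (γ u) ∈ L} ⊇
        π₁ ⁻¹' {y | ∀ γ : 𝒰₁ × 𝒰₂ → 𝒟, ∃ u : 𝒰₁ × 𝒰₂, ξ₁ 0 y t u (γ u) ∈ L₁} ∩
        π₂ ⁻¹' {y | ∀ γ : 𝒰₁ × 𝒰₂ → 𝒟, ∃ u : 𝒰₁ × 𝒰₂, ξ₂ 0 y t u (γ u) ∈ L₂} := by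
  rintro t - z ⟨h1, h2⟩ γ
  simp only [Set.mem_preimage, Set.mem_setOf_eq] at h1 h2
  have k1 : ∃ u, ∀ d, ξ₁ 0 (π₁ z) t u d ∈ L₁ := by
    by_contra hc
    push Not at hc
    choose g hg using hc
    obtain ⟨u, hu⟩ := h1 g
    exact hg u hu
  have k2 : ∃ u, ∀ d, ξ₂ 0 (π₂ z) t u d ∈ L₂ := by
    by_contra hc
    push Not at hc
    choose g hg using hc
    obtain ⟨u, hu⟩ := h2 g
    exact hg u hu
  obtain ⟨⟨a, b⟩, ha⟩ := k1
  obtain ⟨⟨c, e⟩, he⟩ := k2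
  refine ⟨(a, e), ?_⟩
  rw [hL]
  refine ⟨?_, ?_⟩
  · rw [Set.mem_preimage, hcompat₁, hdec₁ 0 (π₁ z) t a e b]
    exact ha _
  · rw [Set.mem_preimage, hcompat₂, hdec₂ 0 (π₂ z) t a c e]
    exact he _
end

section
/- For subsystems with decoupled controls but a shared disturbance, if 𝓛 = bp(𝓛₁) ∪ bp(𝓛₂), then for every t ≤ 0 the reconstruction is a conservative over-approximation of the minimal backward reachable set: 𝓐(t) ⊆ bp(𝓐₁(t)) ∪ bp(𝓐₂(t)). -/
/-- Corollary 6 of the paper. Decoupled controls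
`𝒰 = 𝒰₁ × 𝒰₂` but a shared disturbance (with `Γ` the set of all strategies
`𝒰 → 𝒟`): if `𝓛 = bp(𝓛₁) ∪ bp(𝓛₂)` then the reconstruction
over-approximates the minimal BRS: `𝓐(t) ⊆ bp(𝓐₁(t)) ∪ bp(𝓐₂(t))`. -/
theorem minBRS_union_subset_decoupled_disturbance
    {X₁ X₂ Xc 𝒰₁ 𝒰₂ 𝒟 : Type*} [Nonempty X₁] [Nonempty X₂] [Nonempty Xc]
    [Nonempty 𝒰₁] [Nonempty 𝒰₂] [Nonempty 𝒟]
    (ξ : ℝ → (X₁ × X₂ × Xc) → ℝ → 𝒰₁ × 𝒰₂ → 𝒟 → (X₁ × X₂ × Xc))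
    (ξ₁ : ℝ → (X₁ × Xc) → ℝ → 𝒰₁ × 𝒰₂ → 𝒟 → (X₁ × Xc))
    (ξ₂ : ℝ → (X₂ × Xc) → ℝ → 𝒰₁ × 𝒰₂ → 𝒟 → (X₂ × Xc))
    (π₁ : (X₁ × X₂ × Xc) → X₁ × Xc) (π₂ : (X₁ × X₂ × Xc) → X₂ × Xc)
    (hπ₁ : ∀ z, π₁ z = (z.1, z.2.2)) (hπ₂ : ∀ z, π₂ z = (z.2.1, z.2.2))
    (hcompat₁ : ∀ s z t u d, π₁ (ξ s z t u d) = ξ₁ s (π₁ z) t u d)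
    (hcompat₂ : ∀ s z t u d, π₂ (ξ s z t u d) = ξ₂ s (π₂ z) t u d)
    (hdec₁ : ∀ s y t u₁ u₂ u₂' d, ξ₁ s y t (u₁, u₂) d = ξ₁ s y t (u₁, u₂') d)
    (hdec₂ : ∀ s y t u₁ u₁' u₂ d, ξ₂ s y t (u₁, u₂) d = ξ₂ s y t (u₁', u₂) d)
    (L : Set (X₁ × X₂ × Xc)) (L₁ : Set (X₁ × Xc)) (L₂ : Set (X₂ × Xc))
    (hL : L = π₁ ⁻¹' L₁ ∪ π₂ ⁻¹' L₂) :
    ∀ t ≤ (0 : ℝ),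
      {z | ∃ γ : 𝒰₁ × 𝒰₂ → 𝒟, ∀ u : 𝒰₁ × 𝒰₂, ξ 0 z t u (γ u) ∈ L} ⊆
        π₁ ⁻¹' {y | ∃ γ : 𝒰₁ × 𝒰₂ → 𝒟, ∀ u : 𝒰₁ × 𝒰₂, ξ₁ 0 y t u (γ u) ∈ L₁} ∪
        π₂ ⁻¹' {y | ∃ γ : 𝒰₁ × 𝒰₂ → 𝒟, ∀ u : 𝒰₁ × 𝒰₂, ξ₂ 0 y t u (γ u) ∈ L₂} := by
  intro t _ z hz
  obtain ⟨γ, hγ⟩ := hz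
  by_cases h1 : ∀ u : 𝒰₁ × 𝒰₂, ∃ d, ξ₁ 0 (π₁ z) t u d ∈ L₁
  · left
    choose g hg using h1
    exact ⟨g, hg⟩
  by_cases h2 : ∀ u : 𝒰₁ × 𝒰₂, ∃ d, ξ₂ 0 (π₂ z) t u d ∈ L₂
  · right
    choose g hg using h2
    exact ⟨g, hg⟩
  exfalso
  rw [not_forall] at h1 h2
  obtain ⟨⟨a, b⟩, h1⟩ := h1
  obtain ⟨⟨c, e⟩, h2⟩ := h2
  have h := hγ (a, e)
  rw [hL] at h
  rcases h with h | h
  · rw [Set.mem_preimage, hcompat₁, hdec₁ _ _ _ a e b] at h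
    exact h1 ⟨_, h⟩
  · rw [Set.mem_preimage, hcompat₂, hdec₂ _ _ _ a c e] at h
    exact h2 ⟨_, h⟩
end

section
/- For subsystems with decoupled controls but a shared disturbance, if 𝓛 = bp(𝓛₁) ∪ bp(𝓛₂), then for every t ≤ 0 the reconstruction is a conservative over-approximation of the minimal backward reachable tube: 𝓐ᵀ(t) ⊆ bp(𝓐ᵀ₁(t)) ∪ bp(𝓐ᵀ₂(t)). -/
/-- Corollary 8 of the paper. Decoupled controls
`𝒰 = 𝒰₁ × 𝒰₂` but a shared disturbance (with `Γ` the set of all strategies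
`𝒰 → 𝒟`): if `𝓛 = bp(𝓛₁) ∪ bp(𝓛₂)` then the reconstruction
over-approximates the minimal BRT: `𝓐ᵀ(t) ⊆ bp(𝓐ᵀ₁(t)) ∪ bp(𝓐ᵀ₂(t))`. -/
theorem minBRT_union_subset_decoupled_disturbance
    {X₁ X₂ Xc 𝒰₁ 𝒰₂ 𝒟 : Type*} [Nonempty X₁] [Nonempty X₂] [Nonempty Xc]
    [Nonempty 𝒰₁] [Nonempty 𝒰₂] [Nonempty 𝒟]
    (ξ : ℝ → (X₁ × X₂ × Xc) → ℝ → 𝒰₁ × 𝒰₂ → 𝒟 → (X₁ × X₂ × Xc))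
    (ξ₁ : ℝ → (X₁ × Xc) → ℝ → 𝒰₁ × 𝒰₂ → 𝒟 → (X₁ × Xc))
    (ξ₂ : ℝ → (X₂ × Xc) → ℝ → 𝒰₁ × 𝒰₂ → 𝒟 → (X₂ × Xc))
    (π₁ : (X₁ × X₂ × Xc) → X₁ × Xc) (π₂ : (X₁ × X₂ × Xc) → X₂ × Xc)
    (hπ₁ : ∀ z, π₁ z = (z.1, z.2.2)) (hπ₂ : ∀ z, π₂ z = (z.2.1, z.2.2))
    (hcompat₁ : ∀ s z t u d, π₁ (ξ s z t u d) = ξ₁ s (π₁ z) t u d)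
    (hcompat₂ : ∀ s z t u d, π₂ (ξ s z t u d) = ξ₂ s (π₂ z) t u d)
    (hdec₁ : ∀ s y t u₁ u₂ u₂' d, ξ₁ s y t (u₁, u₂) d = ξ₁ s y t (u₁, u₂') d)
    (hdec₂ : ∀ s y t u₁ u₁' u₂ d, ξ₂ s y t (u₁, u₂) d = ξ₂ s y t (u₁', u₂) d)
    (L : Set (X₁ × X₂ × Xc)) (L₁ : Set (X₁ × Xc)) (L₂ : Set (X₂ × Xc))
    (hL : L = π₁ ⁻¹' L₁ ∪ π₂ ⁻¹' L₂) :
    ∀ t ≤ (0 : ℝ),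
      {z | ∃ γ : 𝒰₁ × 𝒰₂ → 𝒟, ∀ u : 𝒰₁ × 𝒰₂,
          ∃ s ∈ Set.Icc t 0, ξ s z t u (γ u) ∈ L} ⊆
        π₁ ⁻¹' {y | ∃ γ : 𝒰₁ × 𝒰₂ → 𝒟, ∀ u : 𝒰₁ × 𝒰₂,
          ∃ s ∈ Set.Icc t 0, ξ₁ s y t u (γ u) ∈ L₁} ∪
        π₂ ⁻¹' {y | ∃ γ : 𝒰₁ × 𝒰₂ → 𝒟, ∀ u : 𝒰₁ × 𝒰₂,
          ∃ s ∈ Set.Icc t 0, ξ₂ s y t u (γ u) ∈ L₂} := by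
  intro t _ z hz
  obtain ⟨γ, hγ⟩ := hz
  by_cases h1 : ∀ u : 𝒰₁ × 𝒰₂, ∃ d, ∃ s ∈ Set.Icc t 0, ξ₁ s (π₁ z) t u d ∈ L₁
  · left
    choose g hg using h1
    exact ⟨g, hg⟩
  by_cases h2 : ∀ u : 𝒰₁ × 𝒰₂, ∃ d, ∃ s ∈ Set.Icc t 0, ξ₂ s (π₂ z) t u d ∈ L₂
  · right
    choose g hg using h2
    exact ⟨g, hg⟩
  exfalso
  rw [not_forall] at h1 h2
  obtain ⟨⟨a, b⟩, h1⟩ := h1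
  obtain ⟨⟨a', b'⟩, h2⟩ := h2
  obtain ⟨s, hs, h⟩ := hγ (a, b')
  rw [hL] at h
  rcases h with h | h
  · rw [Set.mem_preimage, hcompat₁, hdec₁ s _ t a b' b] at h
    exact h1 ⟨_, s, hs, h⟩
  · rw [Set.mem_preimage, hcompat₂, hdec₂ s _ t a a' b'] at h
    exact h2 ⟨_, s, hs, h⟩
end

section
/- For a time-invariant system with disturbances, the union of the maximal backward reachable sets over the time horizon is a conservative under-approximation of the maximal backward reachable tube: for every t ≤ 0, ⋃_{s ∈ [t, 0]} 𝓡(s) ⊆ 𝓡ᵀ(t). -/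
/-- Corollary 9 of the paper. For a time-invariant system
with disturbances (strategies are all maps `γ : (ℝ → U) → (ℝ → D)`), the union
over the time horizon of the maximal BRSs under-approximates the maximal BRT:
`⋃_{s ∈ [t,0]} 𝓡(s) ⊆ 𝓡ᵀ(t)` for every `t ≤ 0`. -/
theorem union_maxBRS_subset_maxBRT_disturbance
    {Z U D : Type*} [Nonempty Z] [Nonempty U] [Nonempty D]
    (ξ : ℝ → Z → ℝ → (ℝ → U) → (ℝ → D) → Z)
    (htinv : ∀ (τ s t : ℝ) (z : Z) (u : ℝ → U) (d : ℝ → D),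
      ξ s z t u d = ξ (s + τ) z (t + τ) (fun r => u (r - τ)) (fun r => d (r - τ)))
    (L : Set Z) :
    ∀ t ≤ (0 : ℝ),
      (⋃ s ∈ Set.Icc t (0 : ℝ),
        {z | ∀ γ : (ℝ → U) → (ℝ → D), ∃ u : ℝ → U, ξ 0 z s u (γ u) ∈ L}) ⊆
      {z | ∀ γ : (ℝ → U) → (ℝ → D), ∃ u : ℝ → U,
        ∃ s ∈ Set.Icc t (0 : ℝ), ξ s z t u (γ u) ∈ L} := by
  intro t _ z hz
  simp only [Set.mem_iUnion, Set.mem_setOf_eq, exists_prop] at hz ⊢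
  obtain ⟨s, hs, h⟩ := hz
  intro γ
  obtain ⟨u, hu⟩ := h (fun u r => γ (fun r => u (r - (t - s))) (r + (t - s)))
  refine ⟨fun r => u (r - (t - s)), t - s, ⟨by linarith [hs.2], by linarith [hs.1]⟩, ?_⟩
  rw [htinv (t - s)] at hu
  have e1 : (0 : ℝ) + (t - s) = t - s := by ring
  have e2 : s + (t - s) = t := by ring
  simpa only [e1, e2, sub_add_cancel] using hu
end
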